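/- Let X be a topological space and let A and B be subsets of X. If A is a-locally closed and B is e-locally closed, then A ∩ B is e-locally closed. -/

import Mathlib

open Set Topology

/-- A set is regular open if it equals the interior of its closure. -/
def RegOpen {X : Type*} [TopologicalSpace X] (U : Set X) : Prop :=
  U = interior (closure U)

/-- The δ-interior of `A`: the union of all regular open sets contained in `A`. -/
def deltaInt {X : Type*} [TopologicalSpace X] (A : Set X) : Set X :=
  ⋃₀ {U : Set X | RegOpen U ∧ U ⊆ A}

/-- The δ-closure of `A`: the complement of the δ-interior of the complement. -/
def deltaCl {X : Type*} [TopologicalSpace X] (A : Set X) : Set X :=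
  (deltaInt Aᶜ)ᶜ

/-- `A` is a-open if `A ⊆ int(cl(δ-int A))`. -/
def AOpen {X : Type*} [TopologicalSpace X] (A : Set X) : Prop :=
  A ⊆ interior (closure (deltaInt A))

/-- `A` is a-closed if its complement is a-open. -/
def AClosed {X : Type*} [TopologicalSpace X] (A : Set X) : Prop :=
  AOpen Aᶜ

/-- `A` is a-locally closed if it is the intersection of an a-open and an a-closed set. -/
def ALocallyClosed {X : Type*} [TopologicalSpace X] (A : Set X) : Prop :=
  ∃ U V : Set X, AOpen U ∧ AClosed V ∧ A = U ∩ V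

/-- `A` is e-open if `A ⊆ cl(δ-int A) ∪ int(δ-cl A)`. -/
def EOpen {X : Type*} [TopologicalSpace X] (A : Set X) : Prop :=
  A ⊆ closure (deltaInt A) ∪ interior (deltaCl A)

/-- `A` is e-closed if its complement is e-open. -/
def EClosed {X : Type*} [TopologicalSpace X] (A : Set X) : Prop :=
  EOpen Aᶜ

/-- `A` is e-locally closed if it is the intersection of an e-open and an e-closed set. -/
def ELocallyClosed {X : Type*} [TopologicalSpace X] (A : Set X) : Prop :=
  ∃ U V : Set X, EOpen U ∧ EClosed V ∧ A = U ∩ V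

/-- The a-closure of `A`: the intersection of all a-closed supersets of `A`. -/
def aCl {X : Type*} [TopologicalSpace X] (A : Set X) : Set X :=
  ⋂₀ {F : Set X | AClosed F ∧ A ⊆ F}

/-- The a-interior of `A`: the union of all a-open subsets of `A`. -/
def aInt {X : Type*} [TopologicalSpace X] (A : Set X) : Set X :=
  ⋃₀ {U : Set X | AOpen U ∧ U ⊆ A}

/-- The e-closure of `A`: the intersection of all e-closed supersets of `A`. -/
def eCl {X : Type*} [TopologicalSpace X] (A : Set X) : Set X :=
  ⋂₀ {F : Set X | EClosed F ∧ A ⊆ F}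

/-- `S` is semi-open if `S ⊆ cl(int S)`. -/
def SemiOpen {X : Type*} [TopologicalSpace X] (S : Set X) : Prop :=
  S ⊆ closure (interior S)

/-- `S` is semi-closed if its complement is semi-open. -/
def SemiClosed {X : Type*} [TopologicalSpace X] (S : Set X) : Prop :=
  SemiOpen Sᶜ

/-- The semi-closure of `U`: the intersection of all semi-closed supersets of `U`. -/
def sCl {X : Type*} [TopologicalSpace X] (U : Set X) : Set X :=
  ⋂₀ {F : Set X | SemiClosed F ∧ U ⊆ F}

/-- `A` is feebly open if there is an open `U` with `U ⊆ A ⊆ scl(U)`. -/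
def FeeblyOpen {X : Type*} [TopologicalSpace X] (A : Set X) : Prop :=
  ∃ U : Set X, IsOpen U ∧ U ⊆ A ∧ A ⊆ sCl U

/-- `A` is feebly closed if its complement is feebly open. -/
def FeeblyClosed {X : Type*} [TopologicalSpace X] (A : Set X) : Prop :=
  FeeblyOpen Aᶜ

/-- `A` is feebly locally closed if it is the intersection of a feebly open and a
feebly closed set. -/
def FeeblyLocallyClosed {X : Type*} [TopologicalSpace X] (A : Set X) : Prop :=
  ∃ U V : Set X, FeeblyOpen U ∧ FeeblyClosed V ∧ A = U ∩ V

/-- `A` is α-open if `A ⊆ int(cl(int A))`. -/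
def AlphaOpen {X : Type*} [TopologicalSpace X] (A : Set X) : Prop :=
  A ⊆ interior (closure (interior A))

/-- `A` is α-closed if its complement is α-open. -/
def AlphaClosed {X : Type*} [TopologicalSpace X] (A : Set X) : Prop :=
  AlphaOpen Aᶜ

/-- `A` is α-locally closed if it is the intersection of an α-open and an α-closed set. -/
def AlphaLocallyClosed {X : Type*} [TopologicalSpace X] (A : Set X) : Prop :=
  ∃ U V : Set X, AlphaOpen U ∧ AlphaClosed V ∧ A = U ∩ V

/-- `X` is submaximal if every dense subset of `X` is open. -/
def Submaximal (X : Type*) [TopologicalSpace X] : Prop :=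
  ∀ A : Set X, closure A = univ → IsOpen A

/-- `X` is a-submaximal if every a-dense subset of `X` is a-open. -/
def ASubmaximal (X : Type*) [TopologicalSpace X] : Prop :=
  ∀ A : Set X, aCl A = univ → AOpen A

/-- `X` is e-submaximal if every e-dense subset of `X` is e-open. -/
def ESubmaximal (X : Type*) [TopologicalSpace X] : Prop :=
  ∀ A : Set X, eCl A = univ → EOpen A

/-- `X` is an e-space if a subset is open precisely when it is e-open. -/
def IsESpace (X : Type*) [TopologicalSpace X] : Prop :=
  ∀ A : Set X, IsOpen A ↔ EOpen A

theorem RegOpen.isOpen_aux {X : Type*} [TopologicalSpace X] {U : Set X} (h : RegOpen U) :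
    IsOpen U := by
  unfold RegOpen at h
  rw [h]; exact isOpen_interior

theorem RegOpen.inter_aux {X : Type*} [TopologicalSpace X] {U V : Set X} (hU : RegOpen U)
    (hV : RegOpen V) : RegOpen (U ∩ V) := by
  apply Subset.antisymm
  · exact interior_maximal subset_closure (hU.isOpen_aux.inter hV.isOpen_aux)
  · intro x hx
    constructor
    · rw [hU]
      exact interior_mono (closure_mono inter_subset_left) hx
    · rw [hV]
      exact interior_mono (closure_mono inter_subset_right) hx

theorem deltaInt_mono_aux {X : Type*} [TopologicalSpace X] {A B : Set X} (h : A ⊆ B) :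
    deltaInt A ⊆ deltaInt B := by
  rintro x ⟨U, ⟨hU, hUA⟩, hx⟩
  exact ⟨U, ⟨hU, hUA.trans h⟩, hx⟩

theorem deltaCl_mono_aux {X : Type*} [TopologicalSpace X] {A B : Set X} (h : A ⊆ B) :
    deltaCl A ⊆ deltaCl B :=
  compl_subset_compl.2 (deltaInt_mono_aux (compl_subset_compl.2 h))

theorem isOpen_deltaInt_aux {X : Type*} [TopologicalSpace X] (A : Set X) :
    IsOpen (deltaInt A) :=
  isOpen_sUnion fun _ h => h.1.isOpen_aux

theorem mem_deltaCl_aux {X : Type*} [TopologicalSpace X] {A : Set X} {x : X} :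
    x ∈ deltaCl A ↔ ∀ R, RegOpen R → x ∈ R → (R ∩ A).Nonempty := by
  constructor
  · intro h R hR hx
    by_contra hne
    exact h ⟨R, ⟨hR, fun y hy hyA => hne ⟨y, hy, hyA⟩⟩, hx⟩
  · rintro h ⟨R, ⟨hR, hRA⟩, hx⟩
    obtain ⟨y, hy, hyA⟩ := h R hR hx
    exact hRA hy hyA

theorem AOpen.inter_eOpen_aux {X : Type*} [TopologicalSpace X] {U E : Set X} (hU : AOpen U)
    (hE : EOpen E) : EOpen (U ∩ E) := by
  rintro x ⟨hxU, hxE⟩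
  have hx := hU hxU
  rcases hE hxE with h | h
  · left
    rw [mem_closure_iff]
    intro W hW hxW
    obtain ⟨y, ⟨hyW, hyU⟩, hyE⟩ :=
      mem_closure_iff.1 h _ (hW.inter isOpen_interior) ⟨hxW, hx⟩
    obtain ⟨z, ⟨hzW, hzE⟩, hzU⟩ := mem_closure_iff.1 (interior_subset hyU) _
      (hW.inter (isOpen_deltaInt_aux E)) ⟨hyW, hyE⟩
    obtain ⟨R, ⟨hR, hRU⟩, hzR⟩ := hzU
    obtain ⟨S, ⟨hS, hSE⟩, hzS⟩ := hzE
    exact ⟨z, hzW, R ∩ S, ⟨hR.inter_aux hS, inter_subset_inter hRU hSE⟩, hzR, hzS⟩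
  · right
    refine mem_interior.2 ⟨_, ?_, isOpen_interior.inter isOpen_interior, ⟨hx, h⟩⟩
    rintro y ⟨hyU, hyE⟩
    rw [mem_deltaCl_aux]
    intro R hR hyR
    obtain ⟨z, ⟨hzR, hzE⟩, S, ⟨hS, hSU⟩, hzS⟩ := mem_closure_iff.1 (interior_subset hyU) _
      (hR.isOpen_aux.inter isOpen_interior) ⟨hyR, hyE⟩
    obtain ⟨w, ⟨hwR, hwS⟩, hwE⟩ :=
      mem_deltaCl_aux.1 (interior_subset hzE) _ (hR.inter_aux hS) ⟨hzR, hzS⟩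
    exact ⟨w, hwR, hSU hwS, hwE⟩

theorem AOpen.eOpen_aux {X : Type*} [TopologicalSpace X] {U : Set X} (hU : AOpen U) :
    EOpen U := fun _ hx => Or.inl (interior_subset (hU hx))

theorem EOpen.union_aux {X : Type*} [TopologicalSpace X] {U V : Set X} (hU : EOpen U)
    (hV : EOpen V) : EOpen (U ∪ V) := by
  have key : ∀ {S T : Set X}, S ⊆ T → EOpen S →
      S ⊆ closure (deltaInt T) ∪ interior (deltaCl T) := fun h hS =>
    Subset.trans hS (union_subset_union (closure_mono (deltaInt_mono_aux h))
      (interior_mono (deltaCl_mono_aux h)))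
  exact union_subset (key subset_union_left hU) (key subset_union_right hV)

theorem aLocallyClosed_inter_eLocallyClosed {X : Type*} [TopologicalSpace X] (A B : Set X)
    (hA : ALocallyClosed A) (hB : ELocallyClosed B) : ELocallyClosed (A ∩ B) := by
  obtain ⟨U, V, hU, hV, rfl⟩ := hA
  obtain ⟨E, F, hE, hF, rfl⟩ := hB
  refine ⟨U ∩ E, V ∩ F, hU.inter_eOpen_aux hE, ?_, inter_inter_inter_comm U V E F⟩
  unfold EClosed
  rw [compl_inter]
  exact EOpen.union_aux (AOpen.eOpen_aux hV) hF
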